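/- arXiv:2205.15054 — 2 statements merged into one kernel-verified Lean document; each statement's English description precedes it below -/
import Mathlib

section
/- Let Λ ⊆ ℝ be a Lebesgue-measurable set, let β > 0, n ≥ 1 and 1 ≤ j ≤ n. Then the expectation with respect to P_n^β of the random variable (x_1,…,x_n) ↦ ∫_ℝ 1_Λ(x_j)·|ℓ_j(x)|^β dx equals the Lebesgue measure |Λ| of Λ. -/
open MeasureTheory Filter Topology
open scoped ENNReal

/-- The (unnormalized) density of the Gaussian beta-ensemble with potential `x^2/2`. -/
noncomputable def gaussianDensity (n : ℕ) (β : ℝ) (x : Fin n → ℝ) : ℝ :=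
  (∏ p ∈ Finset.univ.filter (fun p : Fin n × Fin n => p.1 < p.2), |x p.1 - x p.2| ^ β) *
    Real.exp (-((n : ℝ) * β / 2) * ∑ j, (x j) ^ 2 / 2)

/-- The weighted Lagrange polynomial associated to the node `x j`. -/
noncomputable def lagrange (n : ℕ) (x : Fin n → ℝ) (j : Fin n) (t : ℝ) : ℝ :=
  (∏ k ∈ Finset.univ.erase j, (t - x k) / (x j - x k)) *
    Real.exp (-(n : ℝ) * (t ^ 2 - (x j) ^ 2) / 4)

/-- The factors of a product over ordered pairs that involve a distinguished index, split off. -/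
theorem prod_lt_insertNth (m : ℕ) (β : ℝ) (j : Fin (m + 1)) (s : ℝ) (y : Fin m → ℝ) :
    (∏ p ∈ Finset.univ.filter (fun p : Fin (m + 1) × Fin (m + 1) => p.1 < p.2),
      |(j.insertNth s y : Fin (m + 1) → ℝ) p.1 - (j.insertNth s y : Fin (m + 1) → ℝ) p.2| ^ β) =
    (∏ k, |s - y k|) ^ β *
      ∏ a, ∏ b, if a < b then |y a - y b| ^ β else 1 := by
  rw [Finset.prod_filter, Fintype.prod_prod_type, Fin.prod_univ_succAbove _ j]
  simp only [Fin.prod_univ_succAbove _ j, Fin.insertNth_apply_same, Fin.insertNth_apply_succAbove,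
    lt_irrefl, if_false, one_mul, Fin.succAbove_lt_succAbove_iff, Finset.prod_mul_distrib]
  rw [← mul_assoc, ← Finset.prod_mul_distrib,
    ← Real.finsetProd_rpow _ _ (fun k _ => abs_nonneg _)]
  congr 1
  refine Finset.prod_congr rfl fun k _ => ?_
  rcases lt_or_gt_of_ne (Fin.succAbove_ne j k) with h | h
  · rw [if_neg h.asymm, if_pos h, one_mul, abs_sub_comm]
  · rw [if_pos h, if_neg h.asymm, mul_one]

theorem lagrange_insertNth (m : ℕ) (j : Fin (m + 1)) (s t : ℝ) (y : Fin m → ℝ) :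
    lagrange (m + 1) (j.insertNth s y) j t =
      (∏ k, (t - y k) / (s - y k)) *
        Real.exp (-((m + 1 : ℕ) : ℝ) * (t ^ 2 - s ^ 2) / 4) := by
  have h : (Finset.univ.erase j : Finset (Fin (m + 1))) =
      Finset.univ.map (Fin.succAboveEmb j) := by
    rw [Fin.univ_succAbove m j, Finset.erase_cons]
  simp [lagrange, h]

theorem gaussianDensity_insertNth (m : ℕ) (β : ℝ) (j : Fin (m + 1)) (s : ℝ) (y : Fin m → ℝ) :
    gaussianDensity (m + 1) β (j.insertNth s y) =
      (∏ k, |s - y k|) ^ β * (∏ a, ∏ b, if a < b then |y a - y b| ^ β else 1) *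
        Real.exp (-(((m + 1 : ℕ) : ℝ) * β / 2) * (s ^ 2 / 2 + ∑ k, (y k) ^ 2 / 2)) := by
  rw [gaussianDensity, prod_lt_insertNth, Fin.sum_univ_succAbove _ j]
  simp

/-- Multiplying the density by `|ℓ_j(t)| ^ β` moves the node `x j` to `t`. -/
theorem gaussianDensity_mul_lagrange (m : ℕ) (β : ℝ) (j : Fin (m + 1)) (s t : ℝ)
    (y : Fin m → ℝ) (hs : ∀ k, s ≠ y k) :
    gaussianDensity (m + 1) β (j.insertNth s y) *
      |lagrange (m + 1) (j.insertNth s y) j t| ^ β =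
    gaussianDensity (m + 1) β (j.insertNth t y) := by
  have hpos : 0 < ∏ k, |s - y k| :=
    Finset.prod_pos fun k _ => abs_pos.2 (sub_ne_zero.2 (hs k))
  rw [gaussianDensity_insertNth, gaussianDensity_insertNth, lagrange_insertNth, abs_mul,
    Finset.abs_prod, Real.abs_exp, Real.mul_rpow (by positivity) (by positivity),
    ← Real.exp_mul]
  simp only [abs_div]
  rw [Finset.prod_div_distrib, Real.div_rpow (by positivity) hpos.le]
  have hne : (∏ k, |s - y k|) ^ β ≠ 0 := (Real.rpow_pos_of_pos hpos β).ne'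
  have hexp : Real.exp (-(((m + 1 : ℕ) : ℝ) * β / 2) * (t ^ 2 / 2 + ∑ k, (y k) ^ 2 / 2)) =
      Real.exp (-(((m + 1 : ℕ) : ℝ) * β / 2) * (s ^ 2 / 2 + ∑ k, (y k) ^ 2 / 2)) *
        Real.exp (-((m + 1 : ℕ) : ℝ) * (t ^ 2 - s ^ 2) / 4 * β) := by
    rw [← Real.exp_add]
    congr 1
    ring
  rw [hexp]
  field_simp

theorem gaussianDensity_nonneg (n : ℕ) (β : ℝ) (x : Fin n → ℝ) : 0 ≤ gaussianDensity n β x := by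
  unfold gaussianDensity
  positivity

@[fun_prop]
theorem measurable_gaussianDensity (n : ℕ) (β : ℝ) : Measurable (gaussianDensity n β) := by
  unfold gaussianDensity
  fun_prop

theorem measurable_lagrange (n : ℕ) (j : Fin n) :
    Measurable fun q : (Fin n → ℝ) × ℝ => lagrange n q.1 j q.2 := by
  unfold lagrange
  fun_prop

/-- Integration over `Fin (m + 1) → ℝ` with the `j`-th coordinate innermost. -/
theorem lintegral_insertNth (m : ℕ) (j : Fin (m + 1)) {f : (Fin (m + 1) → ℝ) → ℝ≥0∞}
    (hf : Measurable f) :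
    ∫⁻ x, f x = ∫⁻ y : Fin m → ℝ, ∫⁻ s : ℝ, f (j.insertNth s y) := by
  have e := (volume_preserving_piFinSuccAbove (fun _ : Fin (m + 1) => ℝ) j).symm
  rw [← e.lintegral_comp_emb (MeasurableEquiv.measurableEmbedding _), Measure.volume_eq_prod]
  exact lintegral_prod_symm' _ (hf.comp (MeasurableEquiv.measurable _))

/-- The expected mass of the Lagrange polynomial localized on a set equals its Lebesgue
measure. -/
theorem lagrange_expectation
    (n : ℕ) (hn : 1 ≤ n) (β : ℝ) (hβ : 0 < β) (j : Fin n)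
    (Λ : Set ℝ) (hΛ : MeasurableSet Λ)
    (Z : ℝ) (hZ : 0 < Z)
    (μ : Measure (Fin n → ℝ))
    (hμ : μ = volume.withDensity (fun x => ENNReal.ofReal (gaussianDensity n β x / Z)))
    (hμprob : IsProbabilityMeasure μ) :
    ∫⁻ x, (∫⁻ t : ℝ,
        Λ.indicator (fun _ => (1 : ℝ≥0∞)) (x j) *
          ENNReal.ofReal (|lagrange n x j t| ^ β)) ∂μ = volume Λ := by
  obtain ⟨m, rfl⟩ : ∃ m, n = m + 1 := ⟨n - 1, by omega⟩
  have hD : Measurable fun x => ENNReal.ofReal (gaussianDensity (m + 1) β x / Z) := by fun_prop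
  have hI : Measurable (Λ.indicator (fun _ => (1 : ℝ≥0∞))) := measurable_const.indicator hΛ
  have hL : Measurable fun x : Fin (m + 1) → ℝ => ∫⁻ t : ℝ,
      Λ.indicator (fun _ => (1 : ℝ≥0∞)) (x j) *
        ENNReal.ofReal (|lagrange (m + 1) x j t| ^ β) := by
    refine Measurable.lintegral_prod_right' (f := fun q : (Fin (m + 1) → ℝ) × ℝ =>
      Λ.indicator (fun _ => (1 : ℝ≥0∞)) (q.1 j) *
        ENNReal.ofReal (|lagrange (m + 1) q.1 j q.2| ^ β)) ?_
    refine (hI.comp (by fun_prop)).mul (ENNReal.measurable_ofReal.comp ?_)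
    exact (continuous_abs.measurable.comp (measurable_lagrange (m + 1) j)).pow_const β
  have hmass : ∫⁻ y : Fin m → ℝ, ∫⁻ t : ℝ,
      ENNReal.ofReal (gaussianDensity (m + 1) β (j.insertNth t y) / Z) = 1 := by
    rw [← lintegral_insertNth m j hD, ← setLIntegral_univ,
      ← withDensity_apply _ MeasurableSet.univ, ← hμ]
    exact measure_univ
  have hinner (y : Fin m → ℝ) : ∫⁻ s : ℝ,
      ENNReal.ofReal (gaussianDensity (m + 1) β (j.insertNth s y) / Z) *
        ∫⁻ t : ℝ, Λ.indicator (fun _ => (1 : ℝ≥0∞)) s *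
          ENNReal.ofReal (|lagrange (m + 1) (j.insertNth s y) j t| ^ β) =
      volume Λ * ∫⁻ t : ℝ,
        ENNReal.ofReal (gaussianDensity (m + 1) β (j.insertNth t y) / Z) := by
    have hae : ∀ᵐ s : ℝ, ∀ k, s ≠ y k := ae_all_iff.2 fun k => Measure.ae_ne volume (y k)
    rw [← lintegral_indicator_one hΛ, ← lintegral_mul_const _ (measurable_one.indicator hΛ)]
    refine lintegral_congr_ae (hae.mono fun s hs => ?_)
    dsimp only
    rw [← lintegral_const_mul' _ _ ENNReal.ofReal_ne_top,
      ← lintegral_const_mul' _ _ (by by_cases h : s ∈ Λ <;> simp [h])]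
    refine lintegral_congr fun t => ?_
    rw [mul_left_comm, ← ENNReal.ofReal_mul (div_nonneg (gaussianDensity_nonneg _ _ _) hZ.le),
      div_mul_eq_mul_div, gaussianDensity_mul_lagrange m β j s t y hs]
    rfl
  rw [hμ, lintegral_withDensity_eq_lintegral_mul _ hD hL, lintegral_insertNth m j (hD.mul hL)]
  simp only [Pi.mul_apply, Fin.insertNth_apply_same]
  simp_rw [hinner]
  rw [lintegral_const_mul, hmass, mul_one]
  exact Measurable.lintegral_prod_right' (f := fun q : (Fin m → ℝ) × ℝ =>
    ENNReal.ofReal (gaussianDensity (m + 1) β (j.insertNth q.2 q.1) / Z))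
    (hD.comp ((MeasurableEquiv.piFinSuccAbove (fun _ => ℝ) j).symm.measurable.comp measurable_swap))
end

section
/- For every M ≥ 1 there is a constant C > 0 such that for every n ≥ 1 and every y ∈ ℝ with |y| ≤ 2 + M n^{−2/3}: ∫_{−2}^{2} K_n(x,y)² / K_n(x,x)³ dx ≤ C / K_n(y,y)². -/
open MeasureTheory Filter Topology
open scoped ENNReal

/-- Rescaled Hermite function `p_k`. -/
noncomputable def hermiteFun (n k : ℕ) (x : ℝ) : ℝ :=
  (n : ℝ) ^ ((1 : ℝ) / 4) * (2 * Real.pi) ^ (-(1 : ℝ) / 4) *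
    ((Nat.factorial k : ℝ)) ^ (-(1 : ℝ) / 2) *
    Polynomial.aeval (Real.sqrt n * x) (Polynomial.hermite k) *
    Real.exp (-(n : ℝ) * x ^ 2 / 4)

/-- The reproducing kernel of the space of weighted polynomials. -/
noncomputable def Kker (n : ℕ) (x y : ℝ) : ℝ :=
  ∑ k ∈ Finset.range n, hermiteFun n k x * hermiteFun n k y


open Polynomial in
theorem derivative_hermite_succ (k : ℕ) :
    derivative (hermite (k + 1)) = ((k : ℤ[X]) + 1) * hermite k := by
  induction k with
  | zero => simp
  | succ k ih =>
    have h1 : derivative (hermite (k + 1 + 1)) = hermite (k + 1)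
        + X * derivative (hermite (k + 1)) - derivative (derivative (hermite (k + 1))) := by
      rw [hermite_succ (k + 1)]; simp
    have h2 : derivative (derivative (hermite (k + 1)))
        = ((k : ℤ[X]) + 1) * derivative (hermite k) := by
      rw [ih]; simp
    have h3 := hermite_succ k
    rw [h1, h2, ih]
    push_cast
    linear_combination (-((k : ℤ[X]) + 1)) * h3

/-- The `k`-th probabilist Hermite polynomial as a real function. -/
noncomputable def hermiteEval (k : ℕ) (x : ℝ) : ℝ :=
  Polynomial.aeval x (Polynomial.hermite k)

theorem hermiteEval_zero (x : ℝ) : hermiteEval 0 x = 1 := by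
  simp [hermiteEval]

theorem hermiteEval_one (x : ℝ) : hermiteEval 1 x = x := by
  simp [hermiteEval]

theorem hermiteEval_add_two (k : ℕ) (x : ℝ) :
    hermiteEval (k + 2) x = x * hermiteEval (k + 1) x - (k + 1) * hermiteEval k x := by
  unfold hermiteEval
  rw [show k + 2 = k + 1 + 1 from rfl, Polynomial.hermite_succ (k + 1), derivative_hermite_succ]
  simp

theorem hasDerivAt_hermiteEval_succ (k : ℕ) (x : ℝ) :
    HasDerivAt (hermiteEval (k + 1)) ((k + 1) * hermiteEval k x) x := by
  have h := (Polynomial.hermite (k + 1)).hasDerivAt_aeval x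
  rw [derivative_hermite_succ] at h
  exact h.congr_deriv (by simp [hermiteEval])

theorem hermiteEval_neg (k : ℕ) (x : ℝ) :
    hermiteEval k (-x) = (-1) ^ k * hermiteEval k x := by
  induction k using Nat.twoStepInduction with
  | zero => simp [hermiteEval_zero]
  | one => simp [hermiteEval_one]
  | more k ih₀ ih₁ =>
    rw [hermiteEval_add_two, hermiteEval_add_two, ih₀, ih₁]
    ring

/-- The factor of `hermiteFun n k` that does not depend on the polynomial. -/
noncomputable def hermiteWeight (n : ℕ) (x : ℝ) : ℝ :=
  (n : ℝ) ^ ((1 : ℝ) / 4) * (2 * Real.pi) ^ (-(1 : ℝ) / 4) * Real.exp (-(n : ℝ) * x ^ 2 / 4)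

theorem hermiteFun_eq (n k : ℕ) (x : ℝ) :
    hermiteFun n k x = hermiteWeight n x *
      (((Nat.factorial k : ℝ)) ^ (-(1 : ℝ) / 2) * hermiteEval k (Real.sqrt n * x)) := by
  unfold hermiteFun hermiteWeight hermiteEval
  ring

theorem hasDerivAt_hermiteWeight (n : ℕ) (x : ℝ) :
    HasDerivAt (hermiteWeight n) (-(n * x / 2) * hermiteWeight n x) x := by
  unfold hermiteWeight
  have h1 : HasDerivAt (fun x : ℝ => -(n : ℝ) * x ^ 2 / 4) (-(n * x / 2)) x := by
    have := (((hasDerivAt_id x).pow 2).const_mul (-(n : ℝ))).div_const 4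
    exact this.congr_deriv (by simp; ring)
  exact (h1.exp.const_mul ((n : ℝ) ^ ((1 : ℝ) / 4) * (2 * Real.pi) ^ (-(1 : ℝ) / 4))).congr_deriv
    (by ring)

theorem sqrt_mul_factorial_rpow (k : ℕ) :
    √((k : ℝ) + 1) * ((Nat.factorial (k + 1) : ℝ)) ^ (-(1 : ℝ) / 2)
      = ((Nat.factorial k : ℝ)) ^ (-(1 : ℝ) / 2) := by
  rw [Nat.factorial_succ]
  push_cast
  rw [Real.mul_rpow (by positivity) (by positivity), Real.sqrt_eq_rpow, ← mul_assoc,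
    ← Real.rpow_add (by positivity)]
  norm_num

theorem hermiteFun_recurrence (n k : ℕ) (x : ℝ) :
    √((k : ℝ) + 1) * hermiteFun n (k + 1) x
      = √n * x * hermiteFun n k x - √k * hermiteFun n (k - 1) x := by
  rw [hermiteFun_eq, hermiteFun_eq, hermiteFun_eq]
  have h1 := sqrt_mul_factorial_rpow k
  cases k with
  | zero =>
    simp [hermiteEval_one, hermiteEval_zero]
    ring
  | succ k =>
    have h2 := sqrt_mul_factorial_rpow k
    have h3 := hermiteEval_add_two k (√n * x)
    have h4 : √((k : ℝ) + 1) * √((k : ℝ) + 1) = k + 1 := Real.mul_self_sqrt (by positivity)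
    simp only [Nat.add_sub_cancel]
    push_cast at h1 ⊢
    rw [show k + 2 = k + 1 + 1 from rfl] at h3
    rw [h3, ← h2]
    linear_combination
      hermiteWeight n x * (√n * x * hermiteEval (k + 1) (√n * x) - (k + 1) * hermiteEval k (√n * x))
        * h1 + hermiteWeight n x * hermiteEval k (√n * x)
        * (Nat.factorial (k + 1) : ℝ) ^ (-(1 : ℝ) / 2) * h4

theorem hasDerivAt_hermiteFun (n k : ℕ) (x : ℝ) :
    HasDerivAt (hermiteFun n k)
      (√n * √k * hermiteFun n (k - 1) x - n * x / 2 * hermiteFun n k x) x := by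
  have hw := hasDerivAt_hermiteWeight n x
  rw [show hermiteFun n k = fun x => hermiteWeight n x *
    (((Nat.factorial k : ℝ)) ^ (-(1 : ℝ) / 2) * hermiteEval k (Real.sqrt n * x)) from
    funext (hermiteFun_eq n k)]
  rw [hermiteFun_eq]
  cases k with
  | zero =>
    simp only [hermiteEval_zero]
    exact (hw.mul_const ((Nat.factorial 0 : ℝ) ^ (-(1 : ℝ) / 2) * 1)).congr_deriv (by simp)
  | succ k =>
    have hl : HasDerivAt (fun x : ℝ => √n * x) (√n) x := by
      simpa using (hasDerivAt_id x).const_mul (√(n : ℝ))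
    have he := (hasDerivAt_hermiteEval_succ k (√n * x)).comp x hl
    have h2 := sqrt_mul_factorial_rpow k
    have h4 : √((k : ℝ) + 1) * √((k : ℝ) + 1) = k + 1 := Real.mul_self_sqrt (by positivity)
    refine (hw.mul (he.const_mul ((Nat.factorial (k + 1) : ℝ) ^ (-(1 : ℝ) / 2)))).congr_deriv ?_
    simp only [Nat.add_sub_cancel, Function.comp]
    push_cast
    rw [← h2]
    linear_combination -√n * hermiteWeight n x * hermiteEval k (√n * x)
        * (Nat.factorial (k + 1) : ℝ) ^ (-(1 : ℝ) / 2) * h4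

theorem hermiteFun_neg (n k : ℕ) (x : ℝ) :
    hermiteFun n k (-x) = (-1) ^ k * hermiteFun n k x := by
  rw [hermiteFun_eq, hermiteFun_eq, mul_neg, hermiteEval_neg]
  simp only [hermiteWeight, neg_sq]
  ring


theorem sub_mul_sum_hermiteFun (n m : ℕ) (x y : ℝ) :
    √n * ((x - y) * ∑ k ∈ Finset.range m, hermiteFun n k x * hermiteFun n k y)
      = √m * (hermiteFun n m x * hermiteFun n (m - 1) y
          - hermiteFun n (m - 1) x * hermiteFun n m y) := by
  induction m with
  | zero => simp
  | succ m ih =>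
    rw [Finset.sum_range_succ, Nat.add_sub_cancel]
    have hx := hermiteFun_recurrence n m x
    have hy := hermiteFun_recurrence n m y
    push_cast
    linear_combination ih - hermiteFun n m y * hx + hermiteFun n m x * hy

theorem sum_hermiteFun_sq (n m : ℕ) (x : ℝ) :
    ∑ k ∈ Finset.range m, hermiteFun n k x * hermiteFun n k x
      = m * (hermiteFun n m x ^ 2 + hermiteFun n (m - 1) x ^ 2)
        - √n * √m * x * (hermiteFun n m x * hermiteFun n (m - 1) x) := by
  induction m with
  | zero => simp
  | succ m ih =>
    rw [Finset.sum_range_succ, Nat.add_sub_cancel, ih]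
    have hx := hermiteFun_recurrence n m x
    have h1 : √((m : ℝ) + 1) * √((m : ℝ) + 1) = m + 1 := Real.mul_self_sqrt (by positivity)
    have h2 : √(m : ℝ) * √(m : ℝ) = m := Real.mul_self_sqrt (by positivity)
    push_cast
    linear_combination hermiteFun n (m + 1) x ^ 2 * h1
      - hermiteFun n (m - 1) x ^ 2 * h2
      + (- √((m : ℝ) + 1) * hermiteFun n (m + 1) x + √m * hermiteFun n (m - 1) x) * hx

/-- The sum of the two consecutive Hermite functions of index `n` and `n - 1`. -/
noncomputable def hermiteSum (n : ℕ) (x : ℝ) : ℝ := hermiteFun n n x + hermiteFun n (n - 1) x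

/-- The difference of the two consecutive Hermite functions of index `n` and `n - 1`. -/
noncomputable def hermiteDiff (n : ℕ) (x : ℝ) : ℝ := hermiteFun n n x - hermiteFun n (n - 1) x

theorem sub_mul_Kker {n : ℕ} (hn : 1 ≤ n) (x y : ℝ) :
    (x - y) * Kker n x y
      = (hermiteDiff n x * hermiteSum n y - hermiteSum n x * hermiteDiff n y) / 2 := by
  have hn' : 0 < √(n : ℝ) := Real.sqrt_pos.2 (by exact_mod_cast hn)
  have h := mul_left_cancel₀ hn'.ne' (sub_mul_sum_hermiteFun n n x y)
  unfold Kker hermiteDiff hermiteSum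
  linear_combination h

theorem Kker_self (n : ℕ) (x : ℝ) :
    Kker n x x = n / 4 * ((2 - x) * hermiteSum n x ^ 2 + (2 + x) * hermiteDiff n x ^ 2) := by
  have h := sum_hermiteFun_sq n n x
  have h2 : √(n : ℝ) * √(n : ℝ) = n := Real.mul_self_sqrt (by positivity)
  unfold Kker hermiteDiff hermiteSum
  rw [h, h2]
  ring

theorem hasDerivAt_hermiteFun_self (n : ℕ) (x : ℝ) :
    HasDerivAt (hermiteFun n n)
      (n * hermiteFun n (n - 1) x - n * x / 2 * hermiteFun n n x) x := by
  have h := hasDerivAt_hermiteFun n n x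
  rwa [Real.mul_self_sqrt (by positivity)] at h

theorem hasDerivAt_hermiteFun_pred {n : ℕ} (hn : 1 ≤ n) (x : ℝ) :
    HasDerivAt (hermiteFun n (n - 1))
      (n * x / 2 * hermiteFun n (n - 1) x - n * hermiteFun n n x) x := by
  obtain ⟨k, rfl⟩ := Nat.exists_eq_add_of_le' hn
  have h := hasDerivAt_hermiteFun (k + 1) k x
  have hr := hermiteFun_recurrence (k + 1) k x
  have h1 : √((k : ℝ) + 1) * √((k : ℝ) + 1) = k + 1 := Real.mul_self_sqrt (by positivity)
  rw [Nat.add_sub_cancel]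
  refine h.congr_deriv ?_
  push_cast at hr ⊢
  linear_combination √((k : ℝ) + 1) * hr
    + (x * hermiteFun (k + 1) k x - hermiteFun (k + 1) (k + 1) x) * h1

theorem hasDerivAt_hermiteSum {n : ℕ} (hn : 1 ≤ n) (x : ℝ) :
    HasDerivAt (hermiteSum n) (-(n / 2) * (2 + x) * hermiteDiff n x) x := by
  refine ((hasDerivAt_hermiteFun_self n x).add (hasDerivAt_hermiteFun_pred hn x)).congr_deriv ?_
  unfold hermiteDiff
  ring

theorem hasDerivAt_hermiteDiff {n : ℕ} (hn : 1 ≤ n) (x : ℝ) :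
    HasDerivAt (hermiteDiff n) (n / 2 * (2 - x) * hermiteSum n x) x := by
  refine ((hasDerivAt_hermiteFun_self n x).sub (hasDerivAt_hermiteFun_pred hn x)).congr_deriv ?_
  unfold hermiteSum
  ring

theorem hermiteSum_neg_sq {n : ℕ} (hn : 1 ≤ n) (x : ℝ) :
    hermiteSum n (-x) ^ 2 = hermiteDiff n x ^ 2 := by
  obtain ⟨k, rfl⟩ := Nat.exists_eq_add_of_le' hn
  unfold hermiteSum hermiteDiff
  rw [hermiteFun_neg, hermiteFun_neg, Nat.add_sub_cancel, pow_succ]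
  have h : ((-1 : ℝ) ^ k) ^ 2 = 1 := by rw [← pow_mul, mul_comm, pow_mul]; simp
  linear_combination (hermiteFun (k + 1) k x - hermiteFun (k + 1) (k + 1) x) ^ 2 * h

theorem hermiteDiff_neg_sq {n : ℕ} (hn : 1 ≤ n) (x : ℝ) :
    hermiteDiff n (-x) ^ 2 = hermiteSum n x ^ 2 := by
  rw [← hermiteSum_neg_sq hn, neg_neg]

theorem Kker_neg_neg (n : ℕ) (x y : ℝ) : Kker n (-x) (-y) = Kker n x y := by
  unfold Kker
  refine Finset.sum_congr rfl fun k _ => ?_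
  rw [hermiteFun_neg, hermiteFun_neg]
  have h : ((-1 : ℝ) ^ k) ^ 2 = 1 := by rw [← pow_mul, mul_comm, pow_mul]; simp
  linear_combination hermiteFun n k x * hermiteFun n k y * h

theorem Kker_sq_le (n : ℕ) (x y : ℝ) : Kker n x y ^ 2 ≤ Kker n x x * Kker n y y := by
  have h := Finset.sum_mul_sq_le_sq_mul_sq (Finset.range n)
    (fun k => hermiteFun n k x) (fun k => hermiteFun n k y)
  simpa only [Kker, pow_two] using h

theorem hermiteWeight_pos {n : ℕ} (hn : 1 ≤ n) (x : ℝ) : 0 < hermiteWeight n x := by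
  have : (0 : ℝ) < n := by exact_mod_cast hn
  unfold hermiteWeight
  positivity

theorem Kker_self_pos {n : ℕ} (hn : 1 ≤ n) (x : ℝ) : 0 < Kker n x x := by
  unfold Kker
  refine Finset.sum_pos' (fun k _ => mul_self_nonneg _) ⟨0, Finset.mem_range.2 hn, ?_⟩
  have h : 0 < hermiteFun n 0 x := by
    rw [hermiteFun_eq, hermiteEval_zero]
    simpa using hermiteWeight_pos hn x
  positivity

theorem continuous_hermiteFun (n k : ℕ) : Continuous (hermiteFun n k) :=
  continuous_iff_continuousAt.2 fun x => (hasDerivAt_hermiteFun n k x).continuousAt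

theorem hermiteFun_zero_zero_sq (n : ℕ) : (hermiteFun n 0 0 ^ 2) ^ 2 = n / (2 * Real.pi) := by
  have hf : ((Nat.factorial 0 : ℝ)) ^ (-(1 : ℝ) / 2) = 1 := by simp
  rw [hermiteFun_eq, hermiteEval_zero, hermiteWeight, hf]
  have h1 : ((n : ℝ) ^ ((1 : ℝ) / 4)) ^ 4 = n := by
    rw [← Real.rpow_natCast, ← Real.rpow_mul (by positivity)]; norm_num
  have h2 : ((2 * Real.pi) ^ (-(1 : ℝ) / 4)) ^ 4 = (2 * Real.pi)⁻¹ := by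
    rw [← Real.rpow_natCast, ← Real.rpow_mul (by positivity), ← Real.rpow_neg_one]; norm_num
  have h3 : Real.exp (-(n : ℝ) * 0 ^ 2 / 4) = 1 := by simp
  have key : ∀ p q : ℝ, p ^ 4 = n → q ^ 4 = (2 * Real.pi)⁻¹ →
      ((p * q * 1 * (1 * 1)) ^ 2) ^ 2 = n * (2 * Real.pi)⁻¹ := fun p q hp hq => by
    linear_combination q ^ 4 * hp + n * hq
  rw [h3, div_eq_mul_inv]
  exact key _ _ h1 h2

theorem succ_mul_hermiteFun_zero_sq (n k : ℕ) :
    ((k : ℝ) + 1) * hermiteFun n (k + 1) 0 ^ 2 = k * hermiteFun n (k - 1) 0 ^ 2 := by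
  have hx := hermiteFun_recurrence n k 0
  have h1 : √((k : ℝ) + 1) * √((k : ℝ) + 1) = k + 1 := Real.mul_self_sqrt (by positivity)
  have h2 : √(k : ℝ) * √(k : ℝ) = k := Real.mul_self_sqrt (by positivity)
  linear_combination (√((k : ℝ) + 1) * hermiteFun n (k + 1) 0 - √k * hermiteFun n (k - 1) 0) * hx
    - hermiteFun n (k + 1) 0 ^ 2 * h1 + hermiteFun n (k - 1) 0 ^ 2 * h2

theorem hermiteFun_zero_sq_sq_le (n k : ℕ) :
    (hermiteFun n k 0 ^ 2) ^ 2 * (k + 1) ≤ n / (2 * Real.pi) := by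
  induction k using Nat.twoStepInduction with
  | zero => simp [hermiteFun_zero_zero_sq]
  | one =>
    have h := succ_mul_hermiteFun_zero_sq n 0
    simp at h
    rw [h]; simp; positivity
  | more k ih _ =>
    have h := succ_mul_hermiteFun_zero_sq n (k + 1)
    simp only [Nat.add_sub_cancel] at h
    push_cast at h ⊢
    have h' : hermiteFun n (k + 2) 0 ^ 2 = ((k : ℝ) + 1) / (k + 2) * hermiteFun n k 0 ^ 2 := by
      field_simp
      linear_combination h
    rw [h']
    refine le_trans ?_ ih
    rw [mul_pow]
    have h3 : (((k : ℝ) + 1) / (k + 2)) ^ 2 * (k + 2 + 1) ≤ k + 1 := by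
      rw [div_pow, div_mul_eq_mul_div, div_le_iff₀ (by positivity)]
      nlinarith [(Nat.cast_nonneg k : (0 : ℝ) ≤ k)]
    nlinarith [mul_le_mul_of_nonneg_left h3 (sq_nonneg (hermiteFun n k 0 ^ 2))]

theorem le_hermiteFun_zero_sq_add_sq (n m : ℕ) :
    3 / 8 * (n / (2 * Real.pi)) ≤
      ((m : ℝ) + 1 / 2) * (hermiteFun n (m + 1) 0 ^ 2 + hermiteFun n m 0 ^ 2) ^ 2 := by
  have hp : 0 ≤ (n : ℝ) / (2 * Real.pi) := by positivity
  have h0 := hermiteFun_zero_zero_sq n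
  have h1 := succ_mul_hermiteFun_zero_sq n 0
  simp at h1
  induction m using Nat.twoStepInduction with
  | zero => rw [zero_add, h1]; simp; rw [h0]; linarith
  | one =>
    have h2 := succ_mul_hermiteFun_zero_sq n 1
    norm_num at h2
    have h3 : hermiteFun n 2 0 ^ 2 = hermiteFun n 0 0 ^ 2 / 2 := by linarith
    norm_num
    rw [h1, h3]
    norm_num
    nlinarith
  | more m ih _ =>
    have h := succ_mul_hermiteFun_zero_sq n (m + 1)
    have h' := succ_mul_hermiteFun_zero_sq n (m + 2)
    simp only [Nat.add_sub_cancel, show m + 2 - 1 = m + 1 from rfl] at h h'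
    push_cast at h h' ⊢
    have e : hermiteFun n (m + 2) 0 ^ 2 = ((m : ℝ) + 1) / (m + 2) * hermiteFun n m 0 ^ 2 := by
      field_simp
      linear_combination h
    have e' : hermiteFun n (m + 2 + 1) 0 ^ 2
        = ((m : ℝ) + 2) / (m + 3) * hermiteFun n (m + 1) 0 ^ 2 := by
      field_simp
      linear_combination h'
    have hm : (0 : ℝ) ≤ m := Nat.cast_nonneg m
    have hS : ((m : ℝ) + 1) / (m + 2) * (hermiteFun n (m + 1) 0 ^ 2 + hermiteFun n m 0 ^ 2) ≤
        hermiteFun n (m + 2 + 1) 0 ^ 2 + hermiteFun n (m + 2) 0 ^ 2 := by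
      rw [e, e', mul_add]
      have : ((m : ℝ) + 1) / (m + 2) ≤ ((m : ℝ) + 2) / (m + 3) := by
        rw [div_le_div_iff₀ (by positivity) (by positivity)]
        nlinarith
      gcongr
    refine ih.trans ?_
    refine le_trans ?_ (mul_le_mul_of_nonneg_left (pow_le_pow_left₀ (by positivity) hS 2)
      (by positivity))
    rw [mul_pow, ← mul_assoc]
    refine mul_le_mul_of_nonneg_right ?_ (by positivity)
    rw [div_pow, mul_div_assoc', le_div_iff₀ (by positivity)]
    nlinarith

theorem Kker_zero_zero_bounds {n : ℕ} (hn : 1 ≤ n) :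
    (n : ℝ) / 5 ≤ Kker n 0 0 ∧ Kker n 0 0 ≤ 2 * n := by
  have hK : Kker n 0 0 = n * (hermiteFun n n 0 ^ 2 + hermiteFun n (n - 1) 0 ^ 2) := by
    rw [Kker_self]; unfold hermiteSum hermiteDiff; ring
  rw [hK]
  obtain ⟨k, rfl⟩ := Nat.exists_eq_add_of_le' hn
  rw [Nat.add_sub_cancel]
  have h1 := hermiteFun_zero_sq_sq_le (k + 1) (k + 1)
  have h2 := hermiteFun_zero_sq_sq_le (k + 1) k
  have h3 := le_hermiteFun_zero_sq_add_sq (k + 1) k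
  set a := hermiteFun (k + 1) (k + 1) 0 ^ 2 with ha
  set b := hermiteFun (k + 1) k 0 ^ 2 with hb
  have ha0 : 0 ≤ a := sq_nonneg _
  have hb0 : 0 ≤ b := sq_nonneg _
  have hk : (0 : ℝ) ≤ k := Nat.cast_nonneg k
  push_cast at h1 h2 h3 ⊢
  have hpi := Real.pi_gt_three
  have hpi4 := Real.pi_lt_d2
  have hu : ((k : ℝ) + 1) / (2 * Real.pi) ≤ k + 1 := by
    apply div_le_self <;> linarith
  have hl : ((k : ℝ) + 1) * (3 / 20) ≤ (k + 1) / (2 * Real.pi) := by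
    rw [le_div_iff₀ (by positivity)]
    nlinarith
  have ha1 : a ≤ 1 := by
    by_contra hc
    push Not at hc
    have : 1 < a ^ 2 := by nlinarith
    nlinarith
  have hb1 : b ≤ 1 := by
    by_contra hc
    push Not at hc
    have : 1 < b ^ 2 := by nlinarith
    nlinarith
  have hab : 1 / 5 ≤ a + b := by
    by_contra hc
    push Not at hc
    have : (a + b) ^ 2 < (1 / 5) ^ 2 := by gcongr
    nlinarith
  constructor <;> nlinarith

/-- One-sided Grönwall inequality with integrating factor `exp ∘ ρ`. -/
theorem mul_exp_le_mul_exp {g g' ρ ρ' : ℝ → ℝ} {a b : ℝ} (hab : a ≤ b)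
    (hg : ∀ z ∈ Set.Icc a b, HasDerivAt g (g' z) z)
    (hρ : ∀ z ∈ Set.Icc a b, HasDerivAt ρ (ρ' z) z)
    (h : ∀ z ∈ Set.Icc a b, 0 ≤ g' z + ρ' z * g z) :
    g a * Real.exp (ρ a) ≤ g b * Real.exp (ρ b) := by
  have hd : ∀ z ∈ Set.Icc a b, HasDerivAt (fun z => g z * Real.exp (ρ z))
      ((g' z + ρ' z * g z) * Real.exp (ρ z)) z := fun z hz =>
    ((hg z hz).mul (hρ z hz).exp).congr_deriv (by ring)
  refine monotoneOn_of_hasDerivWithinAt_nonneg (convex_Icc a b)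
    (fun z hz => (hd z hz).continuousAt.continuousWithinAt)
    (fun z hz => (hd z (interior_subset hz)).hasDerivWithinAt)
    (fun z hz => mul_nonneg (h z (interior_subset hz)) (Real.exp_pos _).le)
    (Set.left_mem_Icc.2 hab) (Set.right_mem_Icc.2 hab) hab

theorem mul_exp_neg_le_mul_exp_neg {g g' ρ ρ' : ℝ → ℝ} {a b : ℝ} (hab : a ≤ b)
    (hg : ∀ z ∈ Set.Icc a b, HasDerivAt g (g' z) z)
    (hρ : ∀ z ∈ Set.Icc a b, HasDerivAt ρ (ρ' z) z)
    (h : ∀ z ∈ Set.Icc a b, g' z ≤ ρ' z * g z) :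
    g b * Real.exp (-ρ b) ≤ g a * Real.exp (-ρ a) := by
  have := mul_exp_le_mul_exp hab (fun z hz => (hg z hz).neg) (fun z hz => (hρ z hz).neg)
    (fun z hz => by simp only [Pi.neg_apply]; linarith [h z hz])
  simp only [Pi.neg_apply] at this
  linarith

/-- The quadratic form which expresses the diagonal of the kernel. -/
noncomputable def pairForm (n : ℝ) (u v : ℝ → ℝ) (x : ℝ) : ℝ :=
  n / 4 * ((2 - x) * u x ^ 2 + (2 + x) * v x ^ 2)

/-- The first order system satisfied by the sum and the difference of two consecutive Hermite
functions, together with nonnegativity of the associated quadratic form. -/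
structure IsHermitePair (n : ℝ) (u v : ℝ → ℝ) : Prop where
  hasDerivAt_fst : ∀ x, HasDerivAt u (-(n / 2) * (2 + x) * v x) x
  hasDerivAt_snd : ∀ x, HasDerivAt v (n / 2 * (2 - x) * u x) x
  pairForm_nonneg : ∀ x, 0 ≤ pairForm n u v x

namespace IsHermitePair

variable {n ε : ℝ} {u v : ℝ → ℝ}

theorem hasDerivAt_pairForm (H : IsHermitePair n u v) (x : ℝ) :
    HasDerivAt (pairForm n u v) (-(n / 4) * (u x ^ 2 - v x ^ 2)) x := by
  have h1 : HasDerivAt (fun x : ℝ => 2 - x) (-1) x := by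
    simpa using (hasDerivAt_id x).const_sub 2
  have h2 : HasDerivAt (fun x : ℝ => 2 + x) 1 x := by
    simpa using (hasDerivAt_id x).const_add 2
  refine (((h1.mul ((H.hasDerivAt_fst x).pow 2)).add
    (h2.mul ((H.hasDerivAt_snd x).pow 2))).const_mul (n / 4)).congr_deriv ?_
  simp
  ring

theorem mul_abs_mul_le (hn : 0 < n) {z r : ℝ} (hr2 : r ^ 2 = 4 - z ^ 2)
    (hz : 0 ≤ z) (hz2 : z < 2) :
    n * r * |u z * v z| ≤ 2 * pairForm n u v z := by
  have h : 2 * r * |u z * v z| ≤ (2 - z) * u z ^ 2 + (2 + z) * v z ^ 2 := by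
    refine abs_le_of_sq_le_sq' ?_ ?_ |>.2
    · rw [mul_pow, mul_pow, sq_abs, hr2]
      nlinarith [sq_nonneg ((2 - z) * u z ^ 2 - (2 + z) * v z ^ 2)]
    · have : 0 ≤ 2 - z := by linarith
      positivity
  unfold pairForm
  nlinarith

theorem bulk_bounds (H : IsHermitePair n u v) (hn : 0 < n) {x : ℝ} (hx : 0 ≤ x) (hx2 : x < 2)
    (hb : 8 ≤ n * √(4 - x ^ 2) ^ 3) :
    pairForm n u v 0 * √(4 - x ^ 2) ≤ 10 * pairForm n u v x ∧
      pairForm n u v x ≤ 5 / 2 * pairForm n u v 0 * √(4 - x ^ 2) := by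
  set r : ℝ → ℝ := fun z => √(4 - z ^ 2) with hr_def
  set Q := pairForm n u v with hQ
  have hr2 : ∀ z ∈ Set.Icc 0 x, r z ^ 2 = 4 - z ^ 2 := fun z hz =>
    Real.sq_sqrt (by nlinarith [hz.1, hz.2])
  have hr0 : ∀ z ∈ Set.Icc 0 x, 0 < r z := fun z hz =>
    Real.sqrt_pos.2 (by nlinarith [hz.1, hz.2])
  have hrd : ∀ z ∈ Set.Icc 0 x, HasDerivAt r (-z / r z) z := fun z hz => by
    have h1 : HasDerivAt (fun z : ℝ => 4 - z ^ 2) (-(2 * z)) z := by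
      simpa using ((hasDerivAt_id z).pow 2).const_sub 4
    have hpos : 4 - z ^ 2 ≠ 0 := by nlinarith [hz.1, hz.2]
    refine (h1.sqrt hpos).congr_deriv ?_
    have := hr0 z hz
    simp only [hr_def]
    field_simp
  have hnr : ∀ z ∈ Set.Icc 0 x, 8 ≤ n * r z ^ 3 := fun z hz => by
    refine hb.trans ?_
    have : r x ≤ r z := Real.sqrt_le_sqrt (by nlinarith [hz.1, hz.2])
    gcongr
  set g : ℝ → ℝ := fun z => Q z / r z + u z * v z / r z ^ 3 with hg_def
  set g' : ℝ → ℝ := fun z => 3 * z * (u z * v z) / r z ^ 5 with hg'_def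
  set ρ : ℝ → ℝ := fun z => 8 / (3 * n) * (r z ^ 3)⁻¹ with hρ_def
  set ρ' : ℝ → ℝ := fun z => 8 * z / (n * r z ^ 5) with hρ'_def
  have hgd : ∀ z ∈ Set.Icc 0 x, HasDerivAt g (g' z) z := fun z hz => by
    have hr := hr0 z hz
    refine (((H.hasDerivAt_pairForm z).div (hrd z hz) hr.ne').add
      (((H.hasDerivAt_fst z).mul (H.hasDerivAt_snd z)).div ((hrd z hz).pow 3)
        (pow_pos hr 3).ne')).congr_deriv ?_
    have h2 := hr2 z hz
    simp only [hg'_def, Pi.mul_apply, Pi.pow_apply, pairForm]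
    field_simp
    simp only [Nat.add_one_sub_one, Nat.cast_ofNat]
    linear_combination -2 * n * r z ^ 4 * (u z ^ 2 - v z ^ 2) * h2
  have hρd : ∀ z ∈ Set.Icc 0 x, HasDerivAt ρ (ρ' z) z := fun z hz => by
    have hr := hr0 z hz
    refine ((((hrd z hz).pow 3).inv (pow_pos hr 3).ne').const_mul (8 / (3 * n))).congr_deriv ?_
    simp only [hρ'_def, Pi.pow_apply]
    field_simp
    norm_num
    ring
  have hbd : ∀ z ∈ Set.Icc 0 x, |u z * v z / r z ^ 3| ≤ Q z / r z / 4 := fun z hz => by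
    have hr := hr0 z hz
    have h := mul_abs_mul_le (u := u) (v := v) hn (hr2 z hz) hz.1 (hz.2.trans_lt hx2)
    have h8 := hnr z hz
    rw [abs_div, abs_of_pos (pow_pos hr 3), div_div, div_le_div_iff₀ (by positivity) (by positivity)]
    have hq := H.pairForm_nonneg z
    have := abs_nonneg (u z * v z)
    nlinarith [mul_le_mul_of_nonneg_right h8 hq]
  have hglo : ∀ z ∈ Set.Icc 0 x, 3 / 4 * (Q z / r z) ≤ g z := fun z hz => by
    have := neg_le_of_abs_le (hbd z hz)
    simp only [hg_def]; linarith
  have hghi : ∀ z ∈ Set.Icc 0 x, g z ≤ 5 / 4 * (Q z / r z) := fun z hz => by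
    have := le_of_abs_le (hbd z hz)
    simp only [hg_def]; linarith
  have habs : ∀ z ∈ Set.Icc 0 x, |g' z| ≤ ρ' z * g z := fun z hz => by
    have hr := hr0 z hz
    have hz0 := hz.1
    have h := mul_abs_mul_le (u := u) (v := v) hn (hr2 z hz) hz.1 (hz.2.trans_lt hx2)
    calc |g' z| = 3 * z * |u z * v z| / r z ^ 5 := by
          simp only [hg'_def]
          rw [abs_div, abs_mul, abs_of_nonneg (by positivity : 0 ≤ 3 * z),
            abs_of_pos (pow_pos hr 5)]
      _ = 3 * z / (n * r z ^ 5) * (n * r z * |u z * v z| / r z) := by field_simp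
      _ ≤ 3 * z / (n * r z ^ 5) * (2 * Q z / r z) := by gcongr
      _ = ρ' z * (3 / 4 * (Q z / r z)) := by simp only [hρ'_def]; ring
      _ ≤ ρ' z * g z := by
          have : 0 ≤ ρ' z := by simp only [hρ'_def]; positivity
          gcongr
          exact hglo z hz
  have hlow := mul_exp_le_mul_exp hx hgd hρd
    (fun z hz => by linarith [neg_le_of_abs_le (habs z hz)])
  have hupp := mul_exp_neg_le_mul_exp_neg hx hgd hρd (fun z hz => le_of_abs_le (habs z hz))
  have h0 : (0 : ℝ) ∈ Set.Icc 0 x := ⟨le_rfl, hx⟩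
  have hxx : x ∈ Set.Icc 0 x := ⟨hx, le_rfl⟩
  have hρ0 : ∀ z ∈ Set.Icc 0 x, 0 ≤ ρ z := fun z hz => by
    have := hr0 z hz
    simp only [hρ_def]; positivity
  have hρ1 : ρ x ≤ 1 := by
    have hr := hr0 x hxx
    simp only [hρ_def]
    rw [← div_eq_mul_inv, div_div, div_le_one (by positivity)]
    nlinarith [hnr x hxx]
  have he : Real.exp (ρ x) ≤ 3 :=
    (Real.exp_le_exp.2 hρ1).trans (Real.exp_one_lt_d9.le.trans (by norm_num))
  have hr00 : r 0 = 2 := by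
    simp only [hr_def]
    rw [show (4 : ℝ) - 0 ^ 2 = 2 ^ 2 by norm_num]
    exact Real.sqrt_sq (by norm_num)
  have hrx := hr0 x hxx
  have hQ0 : 0 ≤ Q 0 := H.pairForm_nonneg 0
  have hQx : 0 ≤ Q x := H.pairForm_nonneg x
  have hg0 : 3 / 8 * Q 0 ≤ g 0 := by have := hglo 0 h0; rw [hr00] at this; linarith
  have hg0' : g 0 ≤ 5 / 8 * Q 0 := by have := hghi 0 h0; rw [hr00] at this; linarith
  have hgx := hglo x hxx
  have hgx' := hghi x hxx
  have hqr : 0 ≤ Q x / r x := by positivity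
  have hlow' : g 0 ≤ 3 * g x := by
    calc g 0 ≤ g 0 * Real.exp (ρ 0) :=
          le_mul_of_one_le_right (by linarith) (Real.one_le_exp (hρ0 0 h0))
      _ ≤ g x * Real.exp (ρ x) := hlow
      _ ≤ g x * 3 := mul_le_mul_of_nonneg_left he (by linarith)
      _ = 3 * g x := mul_comm _ _
  have hupp' : g x ≤ 3 * g 0 := by
    calc g x = g x * Real.exp (-ρ x) * Real.exp (ρ x) := by
          rw [mul_assoc, ← Real.exp_add]; simp
      _ ≤ g 0 * Real.exp (-ρ 0) * Real.exp (ρ x) := by gcongr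
      _ ≤ g 0 * 1 * 3 := by
          have : Real.exp (-ρ 0) ≤ 1 := Real.exp_le_one_iff.2 (by linarith [hρ0 0 h0])
          gcongr <;> linarith
      _ = 3 * g 0 := by ring
  have key : Q x = Q x / r x * r x := by field_simp
  constructor
  · have : Q 0 ≤ 10 * (Q x / r x) := by linarith
    calc Q 0 * r x ≤ 10 * (Q x / r x) * r x := by gcongr
      _ = 10 * Q x := by rw [mul_assoc, ← key]
  · have : Q x / r x ≤ 5 / 2 * Q 0 := by linarith
    calc Q x = Q x / r x * r x := key
      _ ≤ 5 / 2 * Q 0 * r x := by gcongr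

theorem bulk_bounds_of_le (H : IsHermitePair n u v) (hε : 0 < ε) (hnε : n * ε ^ 3 = 1)
    (h0 : n / 5 ≤ pairForm n u v 0) (h0' : pairForm n u v 0 ≤ 2 * n) {x : ℝ} (hx : 0 ≤ x)
    (hx2 : x ≤ 2 - 2 * ε ^ 2) :
    n * √(4 - x ^ 2) ≤ 50 * pairForm n u v x ∧ pairForm n u v x ≤ 5 * n * √(4 - x ^ 2) := by
  have hn : 0 < n := by
    by_contra hc
    have : 0 < ε ^ 3 := by positivity
    nlinarith
  have hε2 : 0 < ε ^ 2 := by positivity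
  have hr : 2 * ε ≤ √(4 - x ^ 2) := Real.le_sqrt_of_sq_le (by nlinarith)
  have hb : 8 ≤ n * √(4 - x ^ 2) ^ 3 := by
    calc (8 : ℝ) = n * (2 * ε) ^ 3 := by rw [mul_pow]; linarith
      _ ≤ n * √(4 - x ^ 2) ^ 3 := by gcongr
  obtain ⟨h1, h2⟩ := H.bulk_bounds hn hx (by linarith) hb
  have hs := Real.sqrt_nonneg (4 - x ^ 2)
  constructor <;> nlinarith

/-- The squared norm of a pair in the natural scale of the edge. -/
noncomputable def edgeNorm (ε : ℝ) (u v : ℝ → ℝ) (x : ℝ) : ℝ := ε * u x ^ 2 + v x ^ 2 / ε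

theorem hasDerivAt_edgeNorm (H : IsHermitePair n u v) (hε : 0 < ε) (x : ℝ) :
    HasDerivAt (edgeNorm ε u v) (n * (u x * v x) * (-(2 + x) * ε + (2 - x) / ε)) x := by
  refine ((((H.hasDerivAt_fst x).pow 2).const_mul ε).add
    (((H.hasDerivAt_snd x).pow 2).div_const ε)).congr_deriv ?_
  field_simp
  simp
  ring

theorem two_mul_abs_mul_le_edgeNorm (hε : 0 < ε) (x : ℝ) :
    2 * |u x * v x| ≤ edgeNorm ε u v x := by
  have h : 0 ≤ (ε * |u x| - |v x|) ^ 2 / ε := by positivity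
  have e : (ε * |u x| - |v x|) ^ 2 / ε = ε * |u x| ^ 2 + |v x| ^ 2 / ε - 2 * (|u x| * |v x|) := by
    field_simp
    ring
  rw [e, sq_abs, sq_abs, ← abs_mul] at h
  unfold edgeNorm
  linarith

theorem abs_deriv_edgeNorm_le {M : ℝ} (hM : 1 ≤ M) (hε : 0 < ε) (hε1 : ε ≤ 1)
    (hnε : n * ε ^ 3 = 1) {x : ℝ} (hx : 2 - 2 * ε ^ 2 ≤ x) (hx2 : x ≤ 2 + M * ε ^ 2) :
    |n * (u x * v x) * (-(2 + x) * ε + (2 - x) / ε)| ≤ (M + 3) / ε ^ 2 * edgeNorm ε u v x := by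
  have hn : n = 1 / ε ^ 3 := by field_simp; exact hnε
  have hε2 : 0 < ε ^ 2 := by positivity
  have hε21 : ε ^ 2 ≤ 1 := pow_le_one₀ hε.le hε1
  have h1 : |-(2 + x) * ε + (2 - x) / ε| ≤ (2 * M + 6) * ε := by
    have e : -(2 + x) * ε + (2 - x) / ε = (-(2 + x) * ε ^ 2 + (2 - x)) / ε := by field_simp
    rw [e, abs_div, abs_of_pos hε, div_le_iff₀ hε, abs_le]
    constructor <;> nlinarith
  have h2 := two_mul_abs_mul_le_edgeNorm (u := u) (v := v) hε x
  have h0 := abs_nonneg (u x * v x)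
  have hn0 : 0 < n := by rw [hn]; positivity
  rw [abs_mul, abs_mul, abs_of_pos hn0]
  calc n * |u x * v x| * |-(2 + x) * ε + (2 - x) / ε|
      ≤ n * |u x * v x| * ((2 * M + 6) * ε) := by gcongr
    _ = (M + 3) / ε ^ 2 * (2 * |u x * v x|) := by rw [hn]; field_simp; ring
    _ ≤ (M + 3) / ε ^ 2 * edgeNorm ε u v x := by gcongr

theorem edgeNorm_bounds (H : IsHermitePair n u v) {M : ℝ} (hM : 1 ≤ M) (hε : 0 < ε)
    (hε1 : ε ≤ 1) (hnε : n * ε ^ 3 = 1)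
    (h0 : n / 5 ≤ pairForm n u v 0) (h0' : pairForm n u v 0 ≤ 2 * n) {x : ℝ}
    (hx : 2 - 2 * ε ^ 2 ≤ x) (hx2 : x ≤ 2 + M * ε ^ 2) :
    Real.exp (-((M + 3) * (M + 2))) / 25 ≤ edgeNorm ε u v x ∧
      edgeNorm ε u v x ≤ 30 * Real.exp ((M + 3) * (M + 2)) := by
  have hn : n = 1 / ε ^ 3 := by field_simp; exact hnε
  have hε2 : 0 < ε ^ 2 := by positivity
  have hε21 : ε ^ 2 ≤ 1 := pow_le_one₀ hε.le hε1
  have hn0 : 0 < n := by rw [hn]; positivity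
  set a := 2 - 2 * ε ^ 2 with ha
  have ha0 : 0 ≤ a := by linarith
  have hbase : 1 / 25 ≤ edgeNorm ε u v a ∧ edgeNorm ε u v a ≤ 30 := by
    obtain ⟨h1, h2⟩ := H.bulk_bounds_of_le hε hnε h0 h0' ha0 le_rfl
    have hr1 : 2 * ε ≤ √(4 - a ^ 2) := Real.le_sqrt_of_sq_le (by nlinarith)
    have hr2 : √(4 - a ^ 2) ≤ 3 * ε := Real.sqrt_le_iff.2 ⟨by positivity, by nlinarith⟩
    have e : ε ^ 2 * pairForm n u v a
        = (2 * (ε * u a ^ 2) + (2 + a) * (v a ^ 2 / ε)) / 4 := by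
      unfold pairForm
      rw [hn, show 2 - a = 2 * ε ^ 2 by rw [ha]; ring]
      field_simp
    have h3 : 2 * ε * n ≤ 50 * pairForm n u v a := le_trans (by nlinarith) h1
    have h4 : pairForm n u v a ≤ 15 * (ε * n) := h2.trans (by nlinarith)
    have h5 : ε ^ 2 * (ε * n) = 1 := by linarith
    have h6 : 1 / 25 ≤ ε ^ 2 * pairForm n u v a := by nlinarith
    have h7 : ε ^ 2 * pairForm n u v a ≤ 15 := by nlinarith
    have hu : 0 ≤ ε * u a ^ 2 := by positivity
    have hv : 0 ≤ v a ^ 2 / ε := by positivity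
    rw [e] at h6 h7
    unfold edgeNorm
    constructor <;> nlinarith
  have hd : ∀ z ∈ Set.Icc a x, HasDerivAt (fun z => (M + 3) / ε ^ 2 * z) ((M + 3) / ε ^ 2) z :=
    fun z _ => ((hasDerivAt_id z).const_mul _).congr_deriv (mul_one _)
  have habs := fun z (hz : z ∈ Set.Icc a x) =>
    abs_deriv_edgeNorm_le (u := u) (v := v) hM hε hε1 hnε hz.1 (hz.2.trans hx2)
  have hlow := mul_exp_le_mul_exp hx (fun z _ => H.hasDerivAt_edgeNorm hε z) hd
    (fun z hz => by linarith [neg_le_of_abs_le (habs z hz)])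
  have hupp := mul_exp_neg_le_mul_exp_neg hx (fun z _ => H.hasDerivAt_edgeNorm hε z) hd
    (fun z hz => le_of_abs_le (habs z hz))
  have hlen : (M + 3) / ε ^ 2 * x - (M + 3) / ε ^ 2 * a ≤ (M + 3) * (M + 2) := by
    rw [← mul_sub, div_mul_eq_mul_div, div_le_iff₀ hε2]
    nlinarith
  have hE : Real.exp ((M + 3) / ε ^ 2 * x)
      ≤ Real.exp ((M + 3) / ε ^ 2 * a) * Real.exp ((M + 3) * (M + 2)) := by
    rw [← Real.exp_add]
    exact Real.exp_le_exp.2 (by linarith)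
  have hG0 : 0 ≤ edgeNorm ε u v x := by unfold edgeNorm; positivity
  have hpa := Real.exp_pos ((M + 3) / ε ^ 2 * a)
  have hpx := Real.exp_pos ((M + 3) / ε ^ 2 * x)
  constructor
  · rw [Real.exp_neg, div_eq_mul_inv, ← mul_inv, inv_le_iff_one_le_mul₀ (by positivity)]
    have h1 : edgeNorm ε u v a * Real.exp ((M + 3) / ε ^ 2 * a)
        ≤ edgeNorm ε u v x * Real.exp ((M + 3) * (M + 2)) * Real.exp ((M + 3) / ε ^ 2 * a) :=
      hlow.trans (by nlinarith)
    have h2 := le_of_mul_le_mul_right h1 hpa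
    linarith [hbase.1]
  · rw [Real.exp_neg, Real.exp_neg, ← div_eq_mul_inv, ← div_eq_mul_inv, div_le_div_iff₀ hpx hpa]
      at hupp
    have h1 : edgeNorm ε u v x * Real.exp ((M + 3) / ε ^ 2 * a)
        ≤ edgeNorm ε u v a * Real.exp ((M + 3) * (M + 2)) * Real.exp ((M + 3) / ε ^ 2 * a) := by
      refine hupp.trans ?_
      have : 0 ≤ edgeNorm ε u v a := by linarith [hbase.1]
      nlinarith
    have h2 := le_of_mul_le_mul_right h1 hpa
    refine h2.trans ?_
    gcongr
    exact hbase.2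

theorem le_pairForm_of_edge (H : IsHermitePair n u v) {c : ℝ} (hc : 0 ≤ c) (hε : 0 < ε)
    (hε1 : ε ≤ 1) (hnε : n * ε ^ 3 = 1)
    (hG : ∀ z, 2 - 2 * ε ^ 2 ≤ z → z ≤ 2 + ε ^ 2 → c ≤ edgeNorm ε u v z) {x : ℝ}
    (hx : 2 - 2 * ε ^ 2 ≤ x) (hx2 : x ≤ 2) :
    3 / 40 * c ≤ ε ^ 2 * pairForm n u v x := by
  have hn : n = 1 / ε ^ 3 := by field_simp; exact hnε
  have hε2 : 0 < ε ^ 2 := by positivity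
  have hε21 : ε ^ 2 ≤ 1 := pow_le_one₀ hε.le hε1
  set b := 2 + ε ^ 2 with hb
  have hxb : x ≤ b := by linarith
  have hd : ∀ z ∈ Set.Icc x b, HasDerivAt (fun z => -(1 / ε ^ 2) * z) (-(1 / ε ^ 2)) z :=
    fun z _ => ((hasDerivAt_id z).const_mul _).congr_deriv (mul_one _)
  have hmain := mul_exp_le_mul_exp hxb
    (fun z _ => ((H.hasDerivAt_pairForm z).const_mul (ε ^ 2)).const_sub (3 / 20 * c)) hd
    (fun z hz => by
      have e1 : -(ε ^ 2 * (-(n / 4) * (u z ^ 2 - v z ^ 2)))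
          + -(1 / ε ^ 2) * (3 / 20 * c - ε ^ 2 * pairForm n u v z)
          = ((ε * u z ^ 2 - ε ^ 2 * (v z ^ 2 / ε)) / 4 - 3 / 20 * c
            + ε ^ 2 * pairForm n u v z) / ε ^ 2 := by
        rw [hn]; field_simp; ring
      have e2 : ε ^ 2 * pairForm n u v z
          = ((2 - z) / ε ^ 2 * (ε * u z ^ 2) + (2 + z) * (v z ^ 2 / ε)) / 4 := by
        unfold pairForm
        rw [hn]; field_simp
      rw [e1]
      refine div_nonneg ?_ hε2.le
      have hz1 : 2 - 2 * ε ^ 2 ≤ z := hx.trans hz.1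
      have hGz := hG z hz1 hz.2
      unfold edgeNorm at hGz
      have hQ : 0 ≤ ε ^ 2 * pairForm n u v z := mul_nonneg hε2.le (H.pairForm_nonneg z)
      have hu : 0 ≤ ε * u z ^ 2 := by positivity
      have hv : 0 ≤ v z ^ 2 / ε := by positivity
      have hv' : ε ^ 2 * (v z ^ 2 / ε) ≤ v z ^ 2 / ε := mul_le_of_le_one_left hv hε21
      have ht : -1 ≤ (2 - z) / ε ^ 2 := by
        rw [le_div_iff₀ hε2]; linarith [hz.2]
      generalize ε ^ 2 * pairForm n u v z = F at *
      generalize ε * u z ^ 2 = A at *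
      generalize v z ^ 2 / ε = B at *
      rcases le_total z 2 with h2 | h2
      · have ht0 : 0 ≤ (2 - z) / ε ^ 2 := div_nonneg (by linarith) hε2.le
        nlinarith [mul_nonneg ht0 hu]
      · nlinarith [mul_le_mul_of_nonneg_right ht hu])
  have hQb : 0 ≤ ε ^ 2 * pairForm n u v b := mul_nonneg hε2.le (H.pairForm_nonneg b)
  have hexp : 2 * Real.exp (-(1 / ε ^ 2) * b) ≤ Real.exp (-(1 / ε ^ 2) * x) := by
    have h1 : 1 + -(1 / ε ^ 2) * b ≤ -(1 / ε ^ 2) * x := by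
      have : 1 ≤ 1 / ε ^ 2 * (b - x) := by
        rw [one_div_mul_eq_div, le_div_iff₀ hε2]; linarith
      linarith
    calc 2 * Real.exp (-(1 / ε ^ 2) * b) ≤ Real.exp 1 * Real.exp (-(1 / ε ^ 2) * b) := by
          have := Real.add_one_le_exp (1 : ℝ)
          gcongr
          linarith
      _ = Real.exp (1 + -(1 / ε ^ 2) * b) := by rw [Real.exp_add]
      _ ≤ _ := Real.exp_le_exp.2 h1
  have hpb := Real.exp_pos (-(1 / ε ^ 2) * b)
  have hpx := Real.exp_pos (-(1 / ε ^ 2) * x)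
  have h1 : (3 / 20 * c - ε ^ 2 * pairForm n u v x) * Real.exp (-(1 / ε ^ 2) * x)
      ≤ 3 / 40 * c * Real.exp (-(1 / ε ^ 2) * x) := by
    refine hmain.trans ?_
    nlinarith [mul_nonneg hQb hpb.le, mul_le_mul_of_nonneg_left hexp hc]
  have h2 := le_of_mul_le_mul_right h1 hpx
  linarith

theorem bounds_of_edge (H : IsHermitePair n u v) {M : ℝ} (hM : 1 ≤ M) (hε : 0 < ε)
    (hε1 : ε ≤ 1) (hnε : n * ε ^ 3 = 1)
    (h0 : n / 5 ≤ pairForm n u v 0) (h0' : pairForm n u v 0 ≤ 2 * n) {x w : ℝ}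
    (hx : 2 - 2 * ε ^ 2 ≤ x) (hx2 : x ≤ 2 + M * ε ^ 2) (hw : 0 < w)
    (hw2 : w ^ 2 = |2 - x| + ε ^ 2) :
    u x ^ 2 * w ≤ 30 * Real.exp ((M + 3) * (M + 2)) * (M + 3) ∧
      v x ^ 2 ≤ 30 * Real.exp ((M + 3) * (M + 2)) * (M + 3) * w ∧
      pairForm n u v x ≤ 30 * Real.exp ((M + 3) * (M + 2)) * (M + 3) * n * w ∧
      (x ≤ 2 → n * w ≤
        40 / 3 * (M + 3) * 25 * Real.exp ((M + 3) * (M + 2)) * pairForm n u v x) := by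
  have hn : n = 1 / ε ^ 3 := by field_simp; exact hnε
  have hn0 : 0 < n := by rw [hn]; positivity
  have hε2 : 0 < ε ^ 2 := by positivity
  have hε21 : ε ^ 2 ≤ 1 := pow_le_one₀ hε.le hε1
  have habs : |2 - x| ≤ (M + 2) * ε ^ 2 := abs_le.2 ⟨by nlinarith, by nlinarith⟩
  have hεw : ε ≤ w := by
    refine le_of_sq_le_sq ?_ hw.le
    nlinarith [abs_nonneg (2 - x)]
  have hwε : w ≤ (M + 3) * ε := by
    refine le_of_sq_le_sq ?_ (by positivity)
    nlinarith [mul_pos hε2 (by linarith : 0 < M + 3)]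
  have hG := (H.edgeNorm_bounds hM hε hε1 hnε h0 h0' hx hx2).2
  set D := 30 * Real.exp ((M + 3) * (M + 2)) with hD
  have hD0 : 0 < D := by positivity
  unfold edgeNorm at hG
  have hu : ε * u x ^ 2 ≤ D := le_trans (le_add_of_nonneg_right (by positivity)) hG
  have hv : v x ^ 2 ≤ D * ε :=
    (div_le_iff₀ hε).1 (le_trans (le_add_of_nonneg_left (by positivity)) hG)
  refine ⟨?_, ?_, ?_, ?_⟩
  · calc u x ^ 2 * w ≤ u x ^ 2 * ((M + 3) * ε) := by gcongr
      _ = (ε * u x ^ 2) * (M + 3) := by ring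
      _ ≤ D * (M + 3) := by gcongr
  · calc v x ^ 2 ≤ D * ε := hv
      _ ≤ D * w := by gcongr
      _ ≤ D * (M + 3) * w := by
        gcongr
        exact le_mul_of_one_le_right hD0.le (by linarith)
  · have h1 : (2 - x) * u x ^ 2 ≤ (M + 2) * ε * D := by
      calc (2 - x) * u x ^ 2 ≤ (M + 2) * ε ^ 2 * u x ^ 2 := by
            gcongr; exact (le_abs_self _).trans habs
        _ = (M + 2) * ε * (ε * u x ^ 2) := by ring
        _ ≤ (M + 2) * ε * D := by gcongr
    have h2 : (2 + x) * v x ^ 2 ≤ (M + 4) * (D * ε) := by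
      have : 2 + x ≤ M + 4 := by nlinarith
      have : 0 ≤ 2 + x := by linarith
      gcongr
    calc pairForm n u v x ≤ n / 4 * ((M + 2) * ε * D + (M + 4) * (D * ε)) := by
          unfold pairForm; gcongr
      _ = D * (M + 3) * n * ε / 2 := by ring
      _ ≤ D * (M + 3) * n * w / 2 := by gcongr
      _ ≤ D * (M + 3) * n * w := half_le_self (by positivity)
  · intro hx2'
    have hlow := H.le_pairForm_of_edge (c := Real.exp (-((M + 3) * (M + 2))) / 25)
      (by positivity) hε hε1 hnε
      (fun z hz hz' => (H.edgeNorm_bounds hM hε hε1 hnε h0 h0' hz (by nlinarith)).1) hx hx2'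
    have hnw : ε ^ 2 * (n * w) ≤ M + 3 := by
      calc ε ^ 2 * (n * w) ≤ ε ^ 2 * (n * ((M + 3) * ε)) := by gcongr
        _ = M + 3 := by linear_combination (M + 3) * hnε
    rw [Real.exp_neg] at hlow
    set E := Real.exp ((M + 3) * (M + 2))
    have hE : 0 < E := Real.exp_pos _
    refine le_of_mul_le_mul_left (hnw.trans ?_) hε2
    have h3 : M + 3 = 40 / 3 * (M + 3) * 25 * E * (3 / 40 * (E⁻¹ / 25)) := by field_simp
    calc M + 3 = 40 / 3 * (M + 3) * 25 * E * (3 / 40 * (E⁻¹ / 25)) := h3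
      _ ≤ 40 / 3 * (M + 3) * 25 * E * (ε ^ 2 * pairForm n u v x) := by gcongr
      _ = _ := by ring

theorem bounds_of_bulk (H : IsHermitePair n u v) (hε : 0 < ε) (hnε : n * ε ^ 3 = 1)
    (h0 : n / 5 ≤ pairForm n u v 0) (h0' : pairForm n u v 0 ≤ 2 * n) {x w : ℝ} (hx : 0 ≤ x)
    (hx2 : x ≤ 2 - 2 * ε ^ 2) (hw : 0 < w) (hw2 : w ^ 2 = |2 - x| + ε ^ 2) :
    u x ^ 2 * w ≤ 60 ∧ v x ^ 2 ≤ 20 * w ∧ pairForm n u v x ≤ 10 * n * w ∧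
      n * w ≤ 50 * pairForm n u v x := by
  have hn : n = 1 / ε ^ 3 := by field_simp; exact hnε
  have hn0 : 0 < n := by rw [hn]; positivity
  have hε2 : 0 < ε ^ 2 := by positivity
  obtain ⟨h1, h2⟩ := H.bulk_bounds_of_le hε hnε h0 h0' hx hx2
  rw [abs_of_pos (by linarith)] at hw2
  have hr1 : w ≤ √(4 - x ^ 2) := Real.le_sqrt_of_sq_le (by nlinarith)
  have hr2 : √(4 - x ^ 2) ≤ 2 * w := Real.sqrt_le_iff.2 ⟨by positivity, by nlinarith⟩
  have hup : pairForm n u v x ≤ 10 * n * w := h2.trans (by nlinarith)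
  have hform : (2 - x) * u x ^ 2 + (2 + x) * v x ^ 2 ≤ 40 * w := by
    unfold pairForm at hup
    refine le_of_mul_le_mul_left ?_ hn0
    linarith
  have hu0 := sq_nonneg (u x)
  have hv0 := sq_nonneg (v x)
  refine ⟨?_, by nlinarith, hup, le_trans (by gcongr) h1⟩
  refine le_of_mul_le_mul_right ?_ hw
  nlinarith

end IsHermitePair

/-- Two-sided bounds for a Hermite pair up to the edge. -/
theorem exists_hermitePair_bounds {M : ℝ} (hM : 1 ≤ M) :
    ∃ C : ℝ, 1 ≤ C ∧ ∀ (n ε : ℝ) (u v : ℝ → ℝ), 0 < ε → ε ≤ 1 → n * ε ^ 3 = 1 →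
      IsHermitePair n u v → n / 5 ≤ pairForm n u v 0 → pairForm n u v 0 ≤ 2 * n →
      ∀ x w : ℝ, 0 ≤ x → x ≤ 2 + M * ε ^ 2 → 0 < w → w ^ 2 = |2 - x| + ε ^ 2 →
        u x ^ 2 * w ≤ C ∧ v x ^ 2 ≤ C * w ∧ pairForm n u v x ≤ C * n * w ∧
          (x ≤ 2 → n * w ≤ C * pairForm n u v x) := by
  set C₁ := 30 * Real.exp ((M + 3) * (M + 2)) * (M + 3) with hC₁
  set C₂ := 40 / 3 * (M + 3) * 25 * Real.exp ((M + 3) * (M + 2)) with hC₂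
  have h1 : 0 < C₁ := by positivity
  have h2 : 0 < C₂ := by positivity
  refine ⟨C₁ + C₂ + 60, by linarith, fun n ε u v hε hε1 hnε H h0 h0' x w hx hx2 hw hw2 => ?_⟩
  have hn : n = 1 / ε ^ 3 := by field_simp; exact hnε
  have hnw : 0 < n * w := mul_pos (by rw [hn]; positivity) hw
  have hQ := H.pairForm_nonneg x
  rcases le_total x (2 - 2 * ε ^ 2) with h | h
  · obtain ⟨a, b, c, d⟩ := H.bounds_of_bulk hε hnε h0 h0' hx h hw hw2
    exact ⟨by linarith, by nlinarith, by nlinarith, fun _ => by nlinarith⟩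
  · obtain ⟨a, b, c, d⟩ := H.bounds_of_edge hM hε hε1 hnε h0 h0' h hx2 hw hw2
    exact ⟨by linarith, by nlinarith, by nlinarith, fun hx' => by nlinarith [d hx']⟩

theorem isHermitePair_hermite {n : ℕ} (hn : 1 ≤ n) :
    IsHermitePair n (hermiteSum n) (hermiteDiff n) where
  hasDerivAt_fst := hasDerivAt_hermiteSum hn
  hasDerivAt_snd := hasDerivAt_hermiteDiff hn
  pairForm_nonneg x := (Kker_self_pos hn x).le.trans_eq (Kker_self n x)

/-- The combination of an approximate identity of width `(n * q)⁻¹` centred at `y` and of a term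
concentrated at the edge which dominates the integrand. -/
noncomputable def majorant (n ε q y x : ℝ) : ℝ :=
  n ^ 2 / q / (1 + (n * q * (x - y)) ^ 2) + 1 / (q ^ 3 * (2 - x + ε ^ 2) ^ 2)

theorem integral_le_of_le_majorant {n ε q y A : ℝ} {f : ℝ → ℝ} (hε : 0 < ε)
    (hnε : n * ε ^ 3 = 1) (hq : ε ≤ q) (hA : 0 ≤ A) (hf : Continuous f)
    (h : ∀ x ∈ Set.Icc (0 : ℝ) 2, f x ≤ A * majorant n ε q y x) :
    ∫ x in (0 : ℝ)..2, f x ≤ A * (5 * n / q ^ 2) := by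
  have hn : n = 1 / ε ^ 3 := by field_simp; exact hnε
  have hn0 : 0 < n := by rw [hn]; positivity
  have hq0 : 0 < q := hε.trans_le hq
  have hε2 : 0 < ε ^ 2 := by positivity
  have hmem : ∀ x ∈ Set.uIcc (0 : ℝ) 2, 0 < 2 - x + ε ^ 2 := fun x hx => by
    rw [Set.uIcc_of_le (by norm_num)] at hx
    linarith [hx.2]
  have hcont : ContinuousOn (majorant n ε q y) (Set.uIcc 0 2) := by
    unfold majorant
    refine ContinuousOn.add (Continuous.continuousOn ?_) ?_
    · exact continuous_const.div (by fun_prop) fun x => by positivity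
    · refine continuousOn_const.div (by fun_prop) fun x hx => ?_
      have := hmem x hx
      positivity
  have hderiv : ∀ x ∈ Set.uIcc (0 : ℝ) 2,
      HasDerivAt (fun x => n / q ^ 2 * Real.arctan (n * q * (x - y))
        + 1 / q ^ 3 * (2 - x + ε ^ 2)⁻¹) (majorant n ε q y x) x := fun x hx => by
    have hx0 := hmem x hx
    have h1 : HasDerivAt (fun x => n * q * (x - y)) (n * q) x :=
      (((hasDerivAt_id x).sub_const y).const_mul _).congr_deriv (mul_one _)
    have h2 : HasDerivAt (fun x => 2 - x + ε ^ 2) (-1) x :=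
      ((hasDerivAt_id x).const_sub 2).add_const (ε ^ 2)
    refine ((h1.arctan.const_mul (n / q ^ 2)).add
      ((h2.inv hx0.ne').const_mul (1 / q ^ 3))).congr_deriv ?_
    unfold majorant
    field_simp
  have hmaj := hcont.intervalIntegrable (μ := volume)
  calc ∫ x in (0 : ℝ)..2, f x ≤ ∫ x in (0 : ℝ)..2, A * majorant n ε q y x :=
        intervalIntegral.integral_mono_on (by norm_num) (hf.intervalIntegrable _ _)
          (hmaj.const_mul A) h
    _ = A * ∫ x in (0 : ℝ)..2, majorant n ε q y x := intervalIntegral.integral_const_mul _ _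
    _ ≤ A * (5 * n / q ^ 2) := by
        gcongr
        rw [intervalIntegral.integral_eq_sub_of_hasDerivAt hderiv hmaj]
        have ha := Real.arctan_lt_pi_div_two (n * q * (2 - y))
        have hb := Real.neg_pi_div_two_lt_arctan (n * q * (0 - y))
        have hpi := Real.pi_le_four
        have hc : n / q ^ 2 * Real.arctan (n * q * (2 - y))
            - n / q ^ 2 * Real.arctan (n * q * (0 - y)) ≤ n / q ^ 2 * 4 := by
          rw [← mul_sub]
          gcongr
          linarith
        have hd : 1 / q ^ 3 * (2 - 2 + ε ^ 2)⁻¹ ≤ n / q ^ 2 := by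
          rw [sub_self, zero_add, hn, div_div, ← one_div, one_div_mul_one_div,
            div_le_div_iff₀ (by positivity) (by positivity)]
          nlinarith [mul_le_mul_of_nonneg_left hq (by positivity : 0 ≤ q ^ 2 * ε ^ 2)]
        have he : 0 ≤ 1 / q ^ 3 * (2 - 0 + ε ^ 2)⁻¹ := by positivity
        have e : 5 * n / q ^ 2 = n / q ^ 2 * 4 + n / q ^ 2 := by ring
        rw [e]
        linarith

theorem div_le_majorant {n ε p q x y J a b : ℝ} (hn : 0 < n) (ha : 0 ≤ a) (hb : 0 ≤ b)
    (hp : 0 < p) (hq : 0 < q) (hp2 : p ^ 2 = 2 - x + ε ^ 2) (hpq : |p ^ 2 - q ^ 2| ≤ |x - y|)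
    (hdiag : J ^ 2 ≤ a * (n ^ 2 * (p * q)))
    (hoff : p * q * (x - y) ^ 2 * J ^ 2 ≤ b * (p ^ 2 + q ^ 2)) :
    J ^ 2 / p ^ 3 ≤ (2 * a + 10 * b) * majorant n ε q y x := by
  rw [majorant, ← hp2, mul_add]
  set z := x - y with hz
  have hJ := sq_nonneg J
  have hpq' := abs_le.1 hpq
  rw [← sq_abs z] at hoff
  have hL : 0 ≤ n ^ 2 / q / (1 + (n * q * z) ^ 2) := by positivity
  have hR : 0 ≤ 1 / (q ^ 3 * (p ^ 2) ^ 2) := by positivity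
  rcases le_total |z| (q ^ 2 / 2) with h | h
  · refine le_add_of_le_of_nonneg ?_ (by positivity)
    have h1 : q ^ 2 / 2 ≤ p ^ 2 := by linarith
    have h2 : p ^ 2 ≤ 3 / 2 * q ^ 2 := by linarith
    have e1 : J ^ 2 / p ^ 3 ≤ 2 * a * (n ^ 2 / q) := by
      rw [div_le_iff₀ (by positivity)]
      calc J ^ 2 ≤ a * (n ^ 2 * (p * q)) := hdiag
        _ = 2 * a * (n ^ 2 / q) * (p * (q ^ 2 / 2)) := by field_simp
        _ ≤ 2 * a * (n ^ 2 / q) * (p * p ^ 2) := by gcongr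
        _ = 2 * a * (n ^ 2 / q) * p ^ 3 := by ring
    have e2 : J ^ 2 / p ^ 3 * (n * q * z) ^ 2 ≤ 10 * b * (n ^ 2 / q) := by
      calc J ^ 2 / p ^ 3 * (n * q * z) ^ 2
          = n ^ 2 * q * (p * q * |z| ^ 2 * J ^ 2) / (p ^ 2) ^ 2 := by
            rw [sq_abs]; field_simp
        _ ≤ n ^ 2 * q * (b * (p ^ 2 + q ^ 2)) / (p ^ 2) ^ 2 := by gcongr
        _ ≤ n ^ 2 * q * (b * (3 / 2 * q ^ 2 + q ^ 2)) / (q ^ 2 / 2) ^ 2 := by gcongr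
        _ = 10 * b * (n ^ 2 / q) := by field_simp; ring
    rw [mul_div_assoc', le_div_iff₀ (by positivity)]
    linarith
  · refine le_add_of_nonneg_of_le (by positivity) ?_
    have hz0 : 0 < |z| := lt_of_lt_of_le (by positivity) h
    have h1 : p ^ 2 + q ^ 2 ≤ 5 * |z| := by linarith
    have h3 : q ^ 2 * |z| * (p * q * J ^ 2) ≤ 10 * b * |z| := by
      calc q ^ 2 * |z| * (p * q * J ^ 2) ≤ (2 * |z|) * |z| * (p * q * J ^ 2) := by
            gcongr; linarith
        _ = 2 * (p * q * |z| ^ 2 * J ^ 2) := by ring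
        _ ≤ 2 * (b * (p ^ 2 + q ^ 2)) := by gcongr
        _ ≤ 2 * (b * (5 * |z|)) := by gcongr
        _ = 10 * b * |z| := by ring
    have h4 : p * q ^ 3 * J ^ 2 ≤ 10 * b := by
      refine le_of_mul_le_mul_right ?_ hz0
      linarith
    calc J ^ 2 / p ^ 3 = p * q ^ 3 * J ^ 2 * (1 / (q ^ 3 * (p ^ 2) ^ 2)) := by field_simp
      _ ≤ (10 * b) * (1 / (q ^ 3 * (p ^ 2) ^ 2)) := by gcongr
      _ ≤ (2 * a + 10 * b) * (1 / (q ^ 3 * (p ^ 2) ^ 2)) := by gcongr; linarith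

theorem sq_half_sub_le (a b c d : ℝ) :
    ((a * b - c * d) / 2) ^ 2 ≤ (a ^ 2 * b ^ 2 + c ^ 2 * d ^ 2) / 2 := by
  nlinarith [sq_nonneg (a * b + c * d)]

theorem sub_sq_mul_Kker_sq_le {n : ℕ} (hn : 1 ≤ n) (x y : ℝ) :
    (x - y) ^ 2 * Kker n x y ^ 2 ≤
      (hermiteDiff n x ^ 2 * hermiteSum n y ^ 2 + hermiteSum n x ^ 2 * hermiteDiff n y ^ 2) / 2 := by
  rw [← mul_pow, sub_mul_Kker hn]
  exact sq_half_sub_le _ _ _ _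

theorem sub_sq_le_mul_add_sq {M δ P Q x y : ℝ} (hM : 0 ≤ M) (hδ : 0 ≤ δ)
    (hx : 0 ≤ x) (hx2 : x ≤ 2) (hy : 0 ≤ y) (hy2 : y ≤ 2 + M * δ)
    (hP : 2 - x + δ ≤ P) (hQ : 2 - y + δ ≤ Q) (hQδ : δ ≤ Q) :
    (x - y) ^ 2 ≤ (1 + M) * (P + Q) * (x + y) ^ 2 := by
  have hP0 : 0 ≤ P := by linarith
  have hQ0 : 0 ≤ Q := by linarith
  have hMP := mul_nonneg hM hP0
  have hMQ := mul_le_mul_of_nonneg_left hQδ hM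
  have hMδ := mul_nonneg hM hδ
  have hexp : (1 + M) * (P + Q) = P + Q + M * P + M * Q := by ring
  rcases le_total 1 (P + Q) with hs | hs
  · have h1 : (x - y) ^ 2 ≤ (x + y) ^ 2 := by linarith [mul_nonneg hx hy, sub_sq x y, add_sq x y]
    have h2 : 1 ≤ (1 + M) * (P + Q) := by linarith
    exact h1.trans (le_mul_of_one_le_left (sq_nonneg _) h2)
  · have hx1 : 1 ≤ x := by linarith
    have hy1 : 1 ≤ y := by linarith
    have hd1 : |x - y| ≤ (1 + M) * (P + Q) := abs_le.2 ⟨by linarith, by linarith⟩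
    have hd2 : |x - y| ≤ (x + y) ^ 2 :=
      (abs_le.2 ⟨by linarith, by linarith⟩ : |x - y| ≤ x + y).trans
        (le_self_pow₀ (by linarith) two_ne_zero)
    rw [← sq_abs, pow_two]
    exact mul_le_mul hd1 hd2 (abs_nonneg _) ((abs_nonneg _).trans hd1)

theorem Kker_off_diagonal_bounds {n : ℕ} (hn : 1 ≤ n) {M C ε p q x y : ℝ} (hM : 1 ≤ M)
    (hε1 : ε ^ 2 ≤ 1) (hp : 0 < p) (hq : 0 < q)
    (hx : 0 ≤ x) (hx2 : x ≤ 2) (hy : 0 ≤ y) (hy2 : y ≤ 2 + M * ε ^ 2)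
    (hp2 : p ^ 2 = |2 - x| + ε ^ 2) (hq2 : q ^ 2 = |2 - y| + ε ^ 2)
    (hux : hermiteSum n x ^ 2 * p ≤ C) (hvx : hermiteDiff n x ^ 2 ≤ C * p)
    (huy : hermiteSum n y ^ 2 * q ≤ C) (hvy : hermiteDiff n y ^ 2 ≤ C * q) :
    p * q * (x - y) ^ 2 * Kker n x y ^ 2 ≤ C ^ 2 * (1 + M) * (3 * M + 10) * (p ^ 2 + q ^ 2) ∧
      p * q * (x - y) ^ 2 * Kker n (-x) y ^ 2
        ≤ C ^ 2 * (1 + M) * (3 * M + 10) * (p ^ 2 + q ^ 2) := by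
  have h1 := sub_sq_mul_Kker_sq_le hn x y
  have h2 := sub_sq_mul_Kker_sq_le hn (-x) y
  rw [hermiteSum_neg_sq hn, hermiteDiff_neg_sq hn] at h2
  have hC : 0 ≤ C := le_trans (by positivity) hux
  have hu0 := sq_nonneg (hermiteSum n x)
  have hv0 := sq_nonneg (hermiteDiff n x)
  have hU0 := sq_nonneg (hermiteSum n y)
  have hV0 := sq_nonneg (hermiteDiff n y)
  set a := hermiteSum n x ^ 2
  set b := hermiteDiff n x ^ 2
  set c := hermiteSum n y ^ 2
  set d := hermiteDiff n y ^ 2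
  have hMp : 1 ≤ (1 + M) * (3 * M + 10) := by nlinarith
  constructor
  · calc p * q * (x - y) ^ 2 * Kker n x y ^ 2 = p * q * ((x - y) ^ 2 * Kker n x y ^ 2) := by ring
      _ ≤ p * q * ((b * c + a * d) / 2) := by gcongr
      _ = (p * b * (c * q) + q * d * (a * p)) / 2 := by ring
      _ ≤ (p * (C * p) * C + q * (C * q) * C) / 2 := by gcongr
      _ = C ^ 2 * (p ^ 2 + q ^ 2) / 2 := by ring
      _ ≤ C ^ 2 * (p ^ 2 + q ^ 2) := half_le_self (by positivity)
      _ = C ^ 2 * 1 * (p ^ 2 + q ^ 2) := by ring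
      _ ≤ C ^ 2 * ((1 + M) * (3 * M + 10)) * (p ^ 2 + q ^ 2) := by gcongr
      _ = _ := by ring
  · have hp3 : p ^ 2 ≤ 3 := by
      rw [hp2, abs_of_nonneg (by linarith)]; linarith
    have hq3 : q ^ 2 ≤ M + 3 := by
      have : |2 - y| ≤ M + 2 := abs_le.2 ⟨by nlinarith, by linarith⟩
      linarith
    have hgeom : (x - y) ^ 2 ≤ (1 + M) * (p ^ 2 + q ^ 2) * (x + y) ^ 2 :=
      sub_sq_le_mul_add_sq (by linarith) (sq_nonneg ε) hx hx2 hy hy2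
        (by rw [hp2]; linarith [le_abs_self (2 - x)])
        (by rw [hq2]; linarith [le_abs_self (2 - y)])
        (by rw [hq2]; linarith [abs_nonneg (2 - y)])
    have hsum : p * q * ((-x - y) ^ 2 * Kker n (-x) y ^ 2) ≤ C ^ 2 * (3 * M + 10) := by
      calc p * q * ((-x - y) ^ 2 * Kker n (-x) y ^ 2) ≤ p * q * ((a * c + b * d) / 2) := by gcongr
        _ = ((a * p) * (c * q) + b * d * p * q) / 2 := by ring
        _ ≤ (C * C + (C * p) * (C * q) * p * q) / 2 := by gcongr
        _ = C ^ 2 * (1 + p ^ 2 * q ^ 2) / 2 := by ring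
        _ ≤ C ^ 2 * (1 + p ^ 2 * q ^ 2) := half_le_self (by positivity)
        _ ≤ C ^ 2 * (1 + 3 * (M + 3)) := by gcongr
        _ = C ^ 2 * (3 * M + 10) := by ring
    calc p * q * (x - y) ^ 2 * Kker n (-x) y ^ 2
        ≤ p * q * ((1 + M) * (p ^ 2 + q ^ 2) * (x + y) ^ 2) * Kker n (-x) y ^ 2 := by gcongr
      _ = (1 + M) * (p ^ 2 + q ^ 2) * (p * q * ((-x - y) ^ 2 * Kker n (-x) y ^ 2)) := by ring
      _ ≤ (1 + M) * (p ^ 2 + q ^ 2) * (C ^ 2 * (3 * M + 10)) := by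
        have : 0 < 1 + M := by linarith
        gcongr
      _ = _ := by ring

theorem continuous_Kker_sq_div {n : ℕ} (hn : 1 ≤ n) (y : ℝ) :
    Continuous fun x => Kker n x y ^ 2 / Kker n x x ^ 3 := by
  have h := continuous_hermiteFun n
  refine Continuous.div ?_ ?_ fun x => (pow_pos (Kker_self_pos hn x) 3).ne'
  · unfold Kker
    fun_prop
  · unfold Kker
    fun_prop

theorem exists_integral_Kker_bound {M : ℝ} (hM : 1 ≤ M) :
    ∃ C : ℝ, 0 < C ∧ ∀ n : ℕ, 1 ≤ n → ∀ ε : ℝ, 0 < ε → ε ≤ 1 → n * ε ^ 3 = 1 →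
      ∀ y : ℝ, 0 ≤ y → y ≤ 2 + M * ε ^ 2 →
        (∫ x in (-2 : ℝ)..2, Kker n x y ^ 2 / Kker n x x ^ 3) ≤ C / Kker n y y ^ 2 := by
  obtain ⟨C, hC1, hC⟩ := exists_hermitePair_bounds hM
  have hC0 : 0 < C := by linarith
  set b := C ^ 2 * (1 + M) * (3 * M + 10) with hb
  have hb0 : 0 < b := by positivity
  set B := 2 * C ^ 2 + 10 * b with hB
  have hB0 : 0 < B := by positivity
  refine ⟨10 * C ^ 5 * B, by positivity, fun n hn ε hε hε1 hnε y hy hy2 => ?_⟩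
  have hn0 : (0 : ℝ) < n := by exact_mod_cast hn
  have hε2 : 0 < ε ^ 2 := by positivity
  have hε21 : ε ^ 2 ≤ 1 := pow_le_one₀ hε.le hε1
  obtain ⟨hK0, hK0'⟩ := Kker_zero_zero_bounds hn
  have hself : ∀ z, Kker n z z = pairForm n (hermiteSum n) (hermiteDiff n) z := Kker_self n
  rw [hself] at hK0 hK0'
  have hC' := hC n ε _ _ hε hε1 hnε (isHermitePair_hermite hn) hK0 hK0'
  simp only [← hself] at hC'
  have hqq : 0 < |2 - y| + ε ^ 2 := by positivity
  obtain ⟨q, hq, hq2⟩ : ∃ q : ℝ, 0 < q ∧ q ^ 2 = |2 - y| + ε ^ 2 :=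
    ⟨√(|2 - y| + ε ^ 2), Real.sqrt_pos.2 hqq, Real.sq_sqrt hqq.le⟩
  have hεq : ε ≤ q := le_of_sq_le_sq (by rw [hq2]; linarith [abs_nonneg (2 - y)]) hq.le
  obtain ⟨huy, hvy, hKy, -⟩ := hC' y q hy hy2 hq hq2
  have hKy0 := Kker_self_pos hn y
  have hpoint : ∀ x ∈ Set.Icc (0 : ℝ) 2, ∀ s, s = x ∨ s = -x →
      Kker n s y ^ 2 / Kker n s s ^ 3 ≤ C ^ 3 / n ^ 3 * B * majorant n ε q y x := by
    intro x hx s hs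
    have hss : Kker n s s = Kker n x x := by
      rcases hs with rfl | rfl
      · rfl
      · rw [Kker_neg_neg]
    have hpp : 0 < |2 - x| + ε ^ 2 := by positivity
    obtain ⟨p, hp, hp2⟩ : ∃ p : ℝ, 0 < p ∧ p ^ 2 = |2 - x| + ε ^ 2 :=
      ⟨√(|2 - x| + ε ^ 2), Real.sqrt_pos.2 hpp, Real.sq_sqrt hpp.le⟩
    obtain ⟨hux, hvx, hKx, hKx'⟩ := hC' x p hx.1 (hx.2.trans (by nlinarith)) hp hp2
    have hKx' := hKx' hx.2
    have hKx0 := Kker_self_pos hn x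
    obtain ⟨ho, ho'⟩ := Kker_off_diagonal_bounds hn hM hε21 hp hq hx.1 hx.2 hy hy2 hp2 hq2
      hux hvx huy hvy
    have hoff : p * q * (x - y) ^ 2 * Kker n s y ^ 2 ≤ b * (p ^ 2 + q ^ 2) := by
      rcases hs with rfl | rfl
      · exact ho
      · exact ho'
    have hdiag : Kker n s y ^ 2 ≤ C ^ 2 * (n ^ 2 * (p * q)) := by
      calc Kker n s y ^ 2 ≤ Kker n s s * Kker n y y := Kker_sq_le n s y
        _ ≤ (C * n * p) * (C * n * q) := by rw [hss]; gcongr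
        _ = C ^ 2 * (n ^ 2 * (p * q)) := by ring
    have hlip : |p ^ 2 - q ^ 2| ≤ |x - y| := by
      rw [hp2, hq2, add_sub_add_right_eq_sub]
      refine (abs_abs_sub_abs_le_abs_sub _ _).trans_eq ?_
      rw [show 2 - x - (2 - y) = -(x - y) by ring, abs_neg]
    have hmaj := div_le_majorant (ε := ε) hn0 (by positivity) hb0.le hp hq
      (by rw [hp2, abs_of_nonneg (by linarith [hx.2])]) hlip hdiag hoff
    rw [hss]
    calc Kker n s y ^ 2 / Kker n x x ^ 3 ≤ Kker n s y ^ 2 / (n * p / C) ^ 3 := by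
          gcongr
          rw [div_le_iff₀ hC0]
          linarith
      _ = C ^ 3 / n ^ 3 * (Kker n s y ^ 2 / p ^ 3) := by field_simp
      _ ≤ C ^ 3 / n ^ 3 * (B * majorant n ε q y x) := by gcongr
      _ = _ := by ring
  have hcont := continuous_Kker_sq_div hn y
  have hA : 0 ≤ C ^ 3 / n ^ 3 * B := by positivity
  have hright := integral_le_of_le_majorant hε hnε hεq hA hcont
    (fun x hx => hpoint x hx x (Or.inl rfl))
  have hleft := integral_le_of_le_majorant hε hnε hεq hA (hcont.comp continuous_neg)
    (fun x hx => hpoint x hx (-x) (Or.inr rfl))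
  have hneg := intervalIntegral.integral_comp_neg (a := (0 : ℝ)) (b := 2)
    (fun x => Kker n x y ^ 2 / Kker n x x ^ 3)
  rw [neg_zero] at hneg
  rw [← intervalIntegral.integral_add_adjacent_intervals (b := (0 : ℝ))
    (hcont.intervalIntegrable _ _) (hcont.intervalIntegrable _ _), ← hneg]
  refine (add_le_add hleft hright).trans ?_
  calc C ^ 3 / n ^ 3 * B * (5 * n / q ^ 2) + C ^ 3 / n ^ 3 * B * (5 * n / q ^ 2)
      = 10 * C ^ 5 * B / (C * n * q) ^ 2 := by field_simp; norm_num
    _ ≤ 10 * C ^ 5 * B / Kker n y y ^ 2 := by gcongr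

/-- Off-diagonal kernel estimate. -/
theorem kernel_estimate_one (M : ℝ) (hM : 1 ≤ M) :
    ∃ C : ℝ, 0 < C ∧
      ∀ n : ℕ, 1 ≤ n → ∀ y : ℝ, |y| ≤ 2 + M * (n : ℝ) ^ (-(2 : ℝ) / 3) →
        (∫ x in (-2 : ℝ)..2, Kker n x y ^ 2 / Kker n x x ^ 3) ≤ C / Kker n y y ^ 2 := by
  obtain ⟨C, hC0, hC⟩ := exists_integral_Kker_bound hM
  refine ⟨C, hC0, fun n hn y hy => ?_⟩
  have hn1 : (1 : ℝ) ≤ n := by exact_mod_cast hn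
  have hn0 : (0 : ℝ) < n := by linarith
  set ε : ℝ := (n : ℝ) ^ (-(1 : ℝ) / 3) with hε
  have hε0 : 0 < ε := Real.rpow_pos_of_pos hn0 _
  have hε1 : ε ≤ 1 := Real.rpow_le_one_of_one_le_of_nonpos hn1 (by norm_num)
  have hε2 : (n : ℝ) ^ (-(2 : ℝ) / 3) = ε ^ 2 := by
    rw [hε, ← Real.rpow_natCast, ← Real.rpow_mul hn0.le]; norm_num
  have hε3 : n * ε ^ 3 = 1 := by
    rw [hε, ← Real.rpow_natCast, ← Real.rpow_mul hn0.le]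
    norm_num [Real.rpow_neg_one, hn0.ne']
  rw [hε2] at hy
  rcases le_total 0 y with h | h
  · exact hC n hn ε hε0 hε1 hε3 y h ((le_abs_self y).trans hy)
  · have hmain := hC n hn ε hε0 hε1 hε3 (-y) (by linarith) ((neg_le_abs y).trans hy)
    have hneg := intervalIntegral.integral_comp_neg (a := (-2 : ℝ)) (b := 2)
      (fun x => Kker n x (-y) ^ 2 / Kker n x x ^ 3)
    simp only [Kker_neg_neg, neg_neg] at hneg hmain
    rwa [hneg]
end
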